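/- With G_i(t,s) := min(P_i(t),P_i(s))·(1 − max(P_i(t),P_i(s))) built from cumulative distribution functions P_1,…,P_n on ℝ, γ := ∫∫ max_{1≤i≤n} G_i(t,s) dt ds, and γ_m := ∫_{ℝ^m × ℝ^m} max_{1≤i_m<⋯<i_1≤n} Π_{j=1}^m G_{i_j}(s_j, t_j) ds dt, one has γ_m ≤ γ^m. -/

import Mathlib

open MeasureTheory

/-- With `G_i(t,s) = min(F_i(t),F_i(s))·(1 - max(F_i(t),F_i(s)))` built
from the cdfs `F_1, …, F_n` of probability densities `p_1, …, p_n` on `ℝ`,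
`γ = ∫∫ max_i G_i(t,s) dt ds`, and
`γ_m = ∫∫ max_{i_1 > ⋯ > i_m} Π_{j=1}^m G_{i_j}(s_j, t_j) ds dt`, one has `γ_m ≤ γ^m`. -/
theorem statement10 (n m : ℕ) (hm : 1 ≤ m) (hmn : m ≤ n)
    (p : Fin n → ℝ → ℝ) (hpm : ∀ i, Measurable (p i)) (hp0 : ∀ i x, 0 ≤ p i x)
    (hpi : ∀ i, Integrable (p i)) (hp1 : ∀ i, (∫ x, p i x) = 1)
    (F : Fin n → ℝ → ℝ) (hF : ∀ i r, F i r = ∫ s in Set.Iic r, p i s)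
    (G : Fin n → ℝ → ℝ → ℝ)
    (hG : ∀ i t s, G i t s = min (F i t) (F i s) * (1 - max (F i t) (F i s)))
    (γ : ℝ) (hγ : γ = ∫ q : ℝ × ℝ, ⨆ i, G i q.1 q.2)
    (hγint : Integrable (fun q : ℝ × ℝ => ⨆ i, G i q.1 q.2))
    (γm : ℝ)
    (hγm : γm = ∫ q : (Fin m → ℝ) × (Fin m → ℝ),
        ⨆ ι : {ι : Fin m → Fin n // StrictAnti ι}, ∏ j, G (ι.1 j) (q.1 j) (q.2 j)) :
    γm ≤ γ ^ m := by
  have hF0 : ∀ i r, 0 ≤ F i r := fun i r => by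
    rw [hF]; exact integral_nonneg (fun x => hp0 i x)
  have hF1 : ∀ i r, F i r ≤ 1 := fun i r => by
    rw [hF, ← hp1 i]
    exact setIntegral_le_integral (hpi i) (Filter.Eventually.of_forall (hp0 i))
  have hG0 : ∀ i t s, 0 ≤ G i t s := fun i t s => by
    rw [hG]
    exact mul_nonneg (le_min (hF0 i t) (hF0 i s))
      (sub_nonneg.2 (max_le (hF1 i t) (hF1 i s)))
  set H : ℝ × ℝ → ℝ := fun q => ⨆ i, G i q.1 q.2 with hH
  have hmp := volume_measurePreserving_arrowProdEquivProdArrow ℝ ℝ (Fin m)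
  have hme := (MeasurableEquiv.arrowProdEquivProdArrow ℝ ℝ (Fin m)).measurableEmbedding
  have hprod : Integrable (fun x : Fin m → ℝ × ℝ => ∏ j, H (x j)) :=
    Integrable.fintype_prod (f := fun _ => H) (fun _ => hγint)
  have hint : Integrable (fun q : (Fin m → ℝ) × (Fin m → ℝ) => ∏ j, H (q.1 j, q.2 j)) := by
    rw [← hmp.integrable_comp_emb hme]
    exact hprod
  have heq : (∫ q : (Fin m → ℝ) × (Fin m → ℝ), ∏ j, H (q.1 j, q.2 j)) = γ ^ m := by
    rw [← hmp.integral_comp hme]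
    have h := integral_fintype_prod_volume_eq_pow (ι := Fin m) H
    rw [Fintype.card_fin, ← hγ] at h
    rw [← h]
    rfl
  have hne : Nonempty {ι : Fin m → Fin n // StrictAnti ι} :=
    ⟨⟨fun j => Fin.castLE hmn j.rev, fun a b hab => by
      simpa using hab⟩⟩
  rw [hγm, ← heq]
  refine integral_mono_of_nonneg (Filter.Eventually.of_forall fun q => ?_) hint
    (Filter.Eventually.of_forall fun q => ?_)
  · exact Real.iSup_nonneg fun ι => Finset.prod_nonneg fun j _ => hG0 _ _ _
  · refine ciSup_le fun ι => Finset.prod_le_prod (fun j _ => hG0 _ _ _) fun j _ => ?_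
    exact le_ciSup (f := fun i => G i (q.1 j) (q.2 j)) (Set.finite_range _).bddAbove (ι.1 j)
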